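/- arXiv:1603.04571 — 4 statements merged into one kernel-verified Lean document; each statement's English description precedes it below -/
import Mathlib

section
/- Let m be a positive integer, let α and θ be real numbers, and let x_1,…,x_m be a canonical vertex-selection sequence of length m with Hollywood numerators w_1,…,w_m. Then ∏_{j=1}^m w_j = (∏_{i=0}^{v−1} (θ + i·α)) · ∏_{i=1}^{v} ∏_{r=1}^{d_i − 1} (r − α), where v is the number of distinct values of the sequence and d_i is the final multiplicity of the value i. (Dividing both sides by θ^{↑m} = θ(θ+1)⋯(θ+m−1) gives the finite-dimensional probability formula of the Hollywood model.) -/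
/-- `Vmax x j` is `V_j = max_{l < j} x_l` (over indices `1 ≤ l < j`), with `V_1 = 0`. -/
def Vmax (x : ℕ → ℕ) (j : ℕ) : ℕ := (Finset.Ico 1 j).sup x

/-- `Dcount x j i = #{l < j : x_l = i}` (over indices `1 ≤ l < j`). -/
def Dcount (x : ℕ → ℕ) (j i : ℕ) : ℕ := ((Finset.Ico 1 j).filter (fun l => x l = i)).card

/-- A canonical vertex-selection sequence of length `m`: a sequence of positive integers
with `x 1 = 1` and `x j ≤ 1 + max_{l<j} x l` for all `2 ≤ j ≤ m`. -/
def IsCanonical (m : ℕ) (x : ℕ → ℕ) : Prop :=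
  x 1 = 1 ∧ (∀ j ∈ Finset.Icc 1 m, 1 ≤ x j) ∧
    ∀ j ∈ Finset.Icc 2 m, x j ≤ 1 + Vmax x j

/-- `v`, the number of distinct values of the sequence, which equals `max_{j ≤ m} x j`. -/
def numVertices (m : ℕ) (x : ℕ → ℕ) : ℕ := (Finset.Icc 1 m).sup x

/-- `d i = #{j ≤ m : x_j = i}`, the final multiplicity of the value `i`. -/
def finalMult (m : ℕ) (x : ℕ → ℕ) (i : ℕ) : ℕ :=
  ((Finset.Icc 1 m).filter (fun j => x j = i)).card

/-- The Hollywood numerator at step `j`: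
`w j = D_j(x_j) − α` if `x_j ≤ V_j`, and `w j = θ + α·V_j` if `x_j = V_j + 1`. -/
noncomputable def hollywoodNumerator (x : ℕ → ℕ) (α θ : ℝ) (j : ℕ) : ℝ :=
  if x j ≤ Vmax x j then (Dcount x j (x j) : ℝ) - α else θ + α * (Vmax x j : ℝ)

theorem Vmax_succ (x : ℕ → ℕ) (n : ℕ) : Vmax x (n + 1) = numVertices n x := by
  unfold Vmax numVertices
  congr 1

theorem Dcount_succ (x : ℕ → ℕ) (n i : ℕ) : Dcount x (n + 1) i = finalMult n x i := by
  unfold Dcount finalMult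
  congr 1

theorem numVertices_succ (x : ℕ → ℕ) (n : ℕ) :
    numVertices (n + 1) x = max (numVertices n x) (x (n + 1)) := by
  unfold numVertices
  rw [← Finset.insert_Icc_right_eq_Icc_add_one (by omega), Finset.sup_insert, sup_comm]

theorem finalMult_succ (x : ℕ → ℕ) (n i : ℕ) :
    finalMult (n + 1) x i = finalMult n x i + if i = x (n + 1) then 1 else 0 := by
  unfold finalMult
  rw [← Finset.insert_Icc_right_eq_Icc_add_one (by omega), Finset.filter_insert]
  by_cases h : x (n + 1) = i
  · simp [h]
  · simp [h, Ne.symm h]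

theorem finalMult_eq_zero_of_numVertices_lt {x : ℕ → ℕ} {n i : ℕ} (h : numVertices n x < i) :
    finalMult n x i = 0 := by
  unfold finalMult
  rw [Finset.card_eq_zero, Finset.filter_eq_empty_iff]
  intro j hj hji
  have hle : x j ≤ numVertices n x := Finset.le_sup (f := x) hj
  omega

theorem IsCanonical.of_succ {n : ℕ} {x : ℕ → ℕ} (hx : IsCanonical (n + 1) x) :
    IsCanonical n x := by
  refine ⟨hx.1, fun j hj => hx.2.1 j ?_, fun j hj => hx.2.2 j ?_⟩ <;>
  · simp only [Finset.mem_Icc] at hj ⊢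
    omega

theorem IsCanonical.one_le_last {n : ℕ} {x : ℕ → ℕ} (hx : IsCanonical (n + 1) x) :
    1 ≤ x (n + 1) :=
  hx.2.1 (n + 1) (by simp)

theorem IsCanonical.last_le {n : ℕ} {x : ℕ → ℕ} (hx : IsCanonical (n + 1) x) :
    x (n + 1) ≤ numVertices n x + 1 := by
  rcases Nat.eq_zero_or_pos n with rfl | hn
  · simp [hx.1]
  · have h := hx.2.2 (n + 1) (by simp only [Finset.mem_Icc]; omega)
    rw [Vmax_succ] at h
    omega

theorem IsCanonical.finalMult_pos {n : ℕ} {x : ℕ → ℕ} (hx : IsCanonical n x) {i : ℕ}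
    (h1 : 1 ≤ i) (hi : i ≤ numVertices n x) : 0 < finalMult n x i := by
  induction n with
  | zero =>
    simp only [numVertices, Finset.Icc_eq_empty_of_lt zero_lt_one, Finset.sup_empty,
      Nat.bot_eq_zero] at hi
    omega
  | succ n ih =>
    have hlast := hx.last_le
    rw [numVertices_succ] at hi
    rw [finalMult_succ]
    by_cases hin : i ≤ numVertices n x
    · exact Nat.add_pos_left (ih hx.of_succ hin) _
    · rw [if_pos (by omega)]
      omega

theorem prod_Icc_sub_one_succ (α : ℝ) {c : ℕ} (hc : 0 < c) :
    ∏ r ∈ Finset.Icc 1 (c + 1 - 1), ((r : ℝ) - α) =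
      (∏ r ∈ Finset.Icc 1 (c - 1), ((r : ℝ) - α)) * ((c : ℝ) - α) := by
  obtain ⟨k, rfl⟩ : ∃ k, c = k + 1 := ⟨c - 1, by omega⟩
  simp only [Nat.add_sub_cancel]
  exact Finset.prod_Icc_succ_top (by omega) _

/-- The product of the Hollywood numerators, with the empty sequence allowed. -/
theorem IsCanonical.prod_hollywoodNumerator {m : ℕ} (α θ : ℝ) {x : ℕ → ℕ}
    (hx : IsCanonical m x) :
    ∏ j ∈ Finset.Icc 1 m, hollywoodNumerator x α θ j =
      (∏ i ∈ Finset.range (numVertices m x), (θ + (i : ℝ) * α)) *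
        ∏ i ∈ Finset.Icc 1 (numVertices m x),
          ∏ r ∈ Finset.Icc 1 (finalMult m x i - 1), ((r : ℝ) - α) := by
  induction m with
  | zero => simp [numVertices]
  | succ n ih =>
    have hpos := hx.one_le_last
    have hlast := hx.last_le
    rw [Finset.prod_Icc_succ_top (by omega), ih hx.of_succ, hollywoodNumerator, Vmax_succ,
      Dcount_succ, numVertices_succ]
    by_cases hle : x (n + 1) ≤ numVertices n x
    · have hfactor : ∀ i ∈ Finset.Icc 1 (numVertices n x),
          ∏ r ∈ Finset.Icc 1 (finalMult (n + 1) x i - 1), ((r : ℝ) - α) =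
            (∏ r ∈ Finset.Icc 1 (finalMult n x i - 1), ((r : ℝ) - α)) *
              if i = x (n + 1) then (finalMult n x i : ℝ) - α else 1 := by
        intro i hi
        rw [Finset.mem_Icc] at hi
        rw [finalMult_succ]
        split_ifs
        · exact prod_Icc_sub_one_succ α (hx.of_succ.finalMult_pos hi.1 hi.2)
        · rw [add_zero, mul_one]
      rw [if_pos hle, max_eq_left hle, Finset.prod_congr rfl hfactor, Finset.prod_mul_distrib,
        Finset.prod_ite_eq', if_pos (Finset.mem_Icc.2 ⟨hpos, hle⟩), mul_assoc]
    · have hnew : x (n + 1) = numVertices n x + 1 := by omega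
      have hold : ∀ i ∈ Finset.Icc 1 (numVertices n x),
          ∏ r ∈ Finset.Icc 1 (finalMult (n + 1) x i - 1), ((r : ℝ) - α) =
            ∏ r ∈ Finset.Icc 1 (finalMult n x i - 1), ((r : ℝ) - α) := by
        intro i hi
        rw [Finset.mem_Icc] at hi
        rw [finalMult_succ, if_neg (by omega), add_zero]
      have hone : finalMult (n + 1) x (numVertices n x + 1) = 1 := by
        rw [finalMult_succ, finalMult_eq_zero_of_numVertices_lt (Nat.lt_succ_self _),
          if_pos hnew.symm]
      rw [if_neg hle, max_eq_right (by omega), hnew, Finset.prod_range_succ,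
        Finset.prod_Icc_succ_top (by omega), Finset.prod_congr rfl hold, hone]
      simp only [Nat.sub_self, Finset.Icc_eq_empty_of_lt zero_lt_one, Finset.prod_empty]
      ring

/-- The product of the Hollywood numerators of a canonical vertex-selection sequence equals
`(∏_{i=0}^{v−1} (θ + i·α)) · ∏_{i=1}^{v} ∏_{r=1}^{d_i − 1} (r − α)`. -/
theorem hollywood_numerator_product (m : ℕ) (hm : 0 < m) (α θ : ℝ) (x : ℕ → ℕ)
    (hx : IsCanonical m x) :
    ∏ j ∈ Finset.Icc 1 m, hollywoodNumerator x α θ j =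
      (∏ i ∈ Finset.range (numVertices m x), (θ + (i : ℝ) * α)) *
        ∏ i ∈ Finset.Icc 1 (numVertices m x),
          ∏ r ∈ Finset.Icc 1 (finalMult m x i - 1), ((r : ℝ) - α) :=
  hx.prod_hollywoodNumerator α θ
end

section
/- Let 0 < α < 1 and define p_α(k) = α·Γ(k−α)/(Γ(1−α)·k!) for integers k ≥ 1. Then for every integer K ≥ 0 the series ∑_{k=K+1}^∞ p_α(k) converges and equals Γ(K+1−α)/(Γ(K+1)·Γ(1−α)). In particular (K = 0), ∑_{k=1}^∞ p_α(k) = 1, so p_α is a probability distribution on the positive integers. -/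
open Real

/-- A consequence of log-convexity: `Γ(x + 1 - a) ≤ x ^ (-a) * Γ(x + 1)` for `0 < a < 1`. -/
theorem Gamma_add_one_sub_le_rpow_mul {a x : ℝ} (ha0 : 0 < a) (ha1 : a < 1) (hx : 0 < x) :
    Gamma (x + 1 - a) ≤ x ^ (-a) * Gamma (x + 1) := by
  have h := Real.Gamma_mul_add_mul_le_rpow_Gamma_mul_rpow_Gamma hx
    (add_pos hx one_pos) ha0 (sub_pos.2 ha1) (by ring)
  have hG : 0 < Gamma x := Gamma_pos_of_pos hx
  rw [show a * x + (1 - a) * (x + 1) = x + 1 - a by ring] at h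
  refine h.trans_eq ?_
  rw [Gamma_add_one hx.ne', mul_rpow hx.le hG.le, rpow_sub hx, rpow_sub hG, rpow_neg hx.le]
  have h1 := (rpow_pos_of_pos hx a).ne'
  have h2 := (rpow_pos_of_pos hG a).ne'
  simp only [rpow_one]
  field_simp

theorem tendsto_Gamma_nat_add_one_sub_div {a : ℝ} (ha0 : 0 < a) (ha1 : a < 1) :
    Filter.Tendsto (fun n : ℕ => Gamma ((n : ℝ) + 1 - a) / Gamma ((n : ℝ) + 1))
      Filter.atTop (nhds 0) := by
  refine squeeze_zero' (Filter.Eventually.of_forall fun n => ?_) ?_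
    ((tendsto_rpow_neg_atTop ha0).comp tendsto_natCast_atTop_atTop)
  · have hn : (0 : ℝ) ≤ n := n.cast_nonneg
    exact div_nonneg (Gamma_nonneg_of_nonneg (by linarith)) (Gamma_nonneg_of_nonneg (by linarith))
  · filter_upwards [Filter.eventually_gt_atTop 0] with n hn
    have hn' : (0 : ℝ) < n := Nat.cast_pos.2 hn
    exact (div_le_iff₀ (Gamma_pos_of_pos (by linarith))).2
      (Gamma_add_one_sub_le_rpow_mul ha0 ha1 hn')

/-- A nonnegative telescoping series whose primitive tends to `0`. -/
theorem hasSum_of_eq_sub_of_tendsto_zero {f T : ℕ → ℝ} (hf : ∀ n, 0 ≤ f n)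
    (hT : ∀ n, f n = T n - T (n + 1)) (hlim : Filter.Tendsto T Filter.atTop (nhds 0)) :
    HasSum f (T 0) := by
  rw [hasSum_iff_tendsto_nat_of_nonneg hf]
  simp_rw [hT, Finset.sum_range_sub']
  simpa using hlim.const_sub (T 0)

/-- For `0 < α < 1` and `p_α(k) = α·Γ(k−α)/(Γ(1−α)·k!)`, the tail series
`∑_{k=K+1}^∞ p_α(k)` converges to `Γ(K+1−α)/(Γ(K+1)·Γ(1−α))` for every `K ≥ 0`;
in particular (`K = 0`) `∑_{k=1}^∞ p_α(k) = 1`, so `p_α` is a probability distribution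
on the positive integers. -/
theorem holywood_degree_tail_sum (α : ℝ) (hα0 : 0 < α) (hα1 : α < 1)
    (p : ℕ → ℝ)
    (hp : ∀ k : ℕ, 1 ≤ k →
      p k = α * Gamma ((k : ℝ) - α) / (Gamma (1 - α) * (Nat.factorial k : ℝ))) :
    (∀ K : ℕ, HasSum (fun j : ℕ => p (K + 1 + j))
      (Gamma ((K : ℝ) + 1 - α) / (Gamma ((K : ℝ) + 1) * Gamma (1 - α)))) ∧
    HasSum (fun j : ℕ => p (1 + j)) 1 := by
  have hG : 0 < Gamma (1 - α) := Gamma_pos_of_pos (sub_pos.2 hα1)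
  have tail : ∀ K : ℕ, HasSum (fun j : ℕ => p (K + 1 + j))
      (Gamma ((K : ℝ) + 1 - α) / (Gamma ((K : ℝ) + 1) * Gamma (1 - α))) := by
    intro K
    let T : ℕ → ℝ := fun n => Gamma ((n : ℝ) + 1 - α) / (Gamma ((n : ℝ) + 1) * Gamma (1 - α))
    have hT : Filter.Tendsto T Filter.atTop (nhds 0) := by
      simpa [T, div_div] using
        (tendsto_Gamma_nat_add_one_sub_div hα0 hα1).div_const (Gamma (1 - α))
    have hstep : ∀ n : ℕ, p (n + 1) = T n - T (n + 1) := by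
      intro n
      have hn : (0 : ℝ) ≤ n := n.cast_nonneg
      have hfac : (Nat.factorial n : ℝ) ≠ 0 := Nat.cast_ne_zero.2 n.factorial_ne_zero
      have hrec : Gamma ((n : ℝ) + 1 + 1 - α) = (n + 1 - α) * Gamma (n + 1 - α) := by
        rw [← Gamma_add_one (by linarith : (n : ℝ) + 1 - α ≠ 0)]
        ring_nf
      simp only [T]
      rw [hp _ (Nat.le_add_left 1 n), Gamma_nat_eq_factorial, Gamma_nat_eq_factorial,
        Nat.factorial_succ]
      push_cast
      rw [hrec]
      field_simp
      ring
    have hnonneg : ∀ n : ℕ, 0 ≤ p (n + 1) := by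
      intro n
      have hn : (0 : ℝ) ≤ n := n.cast_nonneg
      rw [hp _ (Nat.le_add_left 1 n)]
      push_cast
      have := Gamma_pos_of_pos (by linarith : 0 < (n : ℝ) + 1 - α)
      positivity
    have h := hasSum_of_eq_sub_of_tendsto_zero (f := fun j => p (K + j + 1))
      (T := fun j => T (K + j)) (fun j => hnonneg (K + j)) (fun j => hstep (K + j))
      (hT.comp (Filter.tendsto_add_atTop_nat K |>.congr fun n => Nat.add_comm n K))
    simpa [T, add_right_comm] using h
  refine ⟨tail, ?_⟩
  simpa [hG.ne'] using tail 0
end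

section
/- Let 0 < α < 1 and define p_α(k) = α·Γ(k−α)/(Γ(1−α)·k!) for integers k ≥ 1. Then k^{α+1}·p_α(k) → α/Γ(1−α) as k → ∞; equivalently, p_α(k) ∼ α·k^{−(α+1)}/Γ(1−α), so that p_α is a power law distribution with exponent γ = 1 + α ∈ (1,2). In particular, Γ(k−α)/Γ(k+1) ∼ k^{−(1+α)} as k → ∞. -/
open Real Filter

theorem Real.Gamma_natCast_add_eq_prod {s : ℝ} (hs : ∀ m : ℕ, s ≠ -m) (n : ℕ) :
    Gamma (n + s) = Gamma s * ∏ j ∈ Finset.range n, (s + j) := by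
  induction n with
  | zero => simp
  | succ n ih =>
    have h : (n : ℝ) + s ≠ 0 := fun h => hs n (by linarith)
    rw [Finset.prod_range_succ, ← mul_assoc, ← ih, Nat.cast_succ, add_right_comm, Gamma_add_one h]
    ring

/-- Asymptotics of a ratio of Gamma values: `Γ(n + s) / Γ(n + 1) ∼ n ^ (s - 1)`. -/
theorem Real.tendsto_Gamma_natCast_add_div_Gamma {s : ℝ} (hs : ∀ m : ℕ, s ≠ -m) :
    Tendsto (fun n : ℕ => Gamma (n + s) / Gamma (n + 1) / (n : ℝ) ^ (s - 1)) atTop (nhds 1) := by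
  have hΓ : Gamma s ≠ 0 := Gamma_ne_zero hs
  have hlim := ((tendsto_const_nhds (x := Gamma s)).div (GammaSeq_tendsto_Gamma s) hΓ).mul
    (tendsto_natCast_div_add_atTop s)
  rw [div_self hΓ, one_mul] at hlim
  refine hlim.congr' ?_
  filter_upwards [eventually_gt_atTop 0] with n hn
  have hn' : (0 : ℝ) < n := Nat.cast_pos.mpr hn
  have h : s + (n : ℝ) ≠ 0 := fun h => hs n (by linarith)
  have hpow : (n : ℝ) ^ s ≠ 0 := (rpow_pos_of_pos hn' s).ne'
  have hfact : (n.factorial : ℝ) ≠ 0 := Nat.cast_ne_zero.mpr n.factorial_ne_zero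
  rw [Pi.div_apply, GammaSeq, Finset.prod_range_succ, Gamma_natCast_add_eq_prod hs,
    Gamma_nat_eq_factorial, rpow_sub_one hn'.ne', add_comm (n : ℝ) s, div_div_eq_mul_div]
  field_simp

/-- Power law behavior of the limiting Hollywood degree distribution: for `0 < α < 1` and
`p_α(k) = α·Γ(k−α)/(Γ(1−α)·k!)`, we have `k^{α+1}·p_α(k) → α/Γ(1−α)` as `k → ∞`, i.e.
`p_α(k) ∼ α·k^{−(α+1)}/Γ(1−α)`, a power law with exponent `γ = 1 + α`. In particular,
`Γ(k−α)/Γ(k+1) ∼ k^{−(1+α)}` as `k → ∞`. -/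
theorem hollywood_degree_power_law (α : ℝ) (hα0 : 0 < α) (hα1 : α < 1)
    (p : ℕ → ℝ)
    (hp : ∀ k : ℕ, 1 ≤ k →
      p k = α * Gamma ((k : ℝ) - α) / (Gamma (1 - α) * (Nat.factorial k : ℝ))) :
    Tendsto (fun k : ℕ => (k : ℝ) ^ (α + 1) * p k) atTop (nhds (α / Gamma (1 - α))) ∧
    Tendsto (fun k : ℕ => p k / (α * (k : ℝ) ^ (-(α + 1)) / Gamma (1 - α))) atTop (nhds 1) ∧
    Tendsto (fun k : ℕ => (Gamma ((k : ℝ) - α) / Gamma ((k : ℝ) + 1)) / (k : ℝ) ^ (-(1 + α)))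
      atTop (nhds 1) := by
  have hratio : Tendsto (fun k : ℕ =>
      (Gamma ((k : ℝ) - α) / Gamma ((k : ℝ) + 1)) / (k : ℝ) ^ (-(1 + α))) atTop (nhds 1) := by
    have hne : ∀ m : ℕ, -α ≠ -m := fun m h => by
      have hm : α = m := neg_injective h
      rw [hm] at hα0 hα1
      norm_cast at hα0 hα1
      omega
    have hexp : -α - 1 = -(1 + α) := by ring
    simpa only [hexp, ← sub_eq_add_neg] using tendsto_Gamma_natCast_add_div_Gamma hne
  have hΓ : Gamma (1 - α) ≠ 0 := (Gamma_pos_of_pos (by linarith)).ne'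
  refine ⟨?_, ?_, hratio⟩
  · have h := hratio.const_mul (α / Gamma (1 - α))
    rw [mul_one] at h
    refine h.congr' ?_
    filter_upwards [eventually_ge_atTop 1] with k hk
    rw [hp k hk, Gamma_nat_eq_factorial, rpow_neg k.cast_nonneg, div_inv_eq_mul, add_comm 1 α]
    ring
  · refine hratio.congr' ?_
    filter_upwards [eventually_ge_atTop 1] with k hk
    have hpow : (k : ℝ) ^ (-(α + 1)) ≠ 0 := (rpow_pos_of_pos (Nat.cast_pos.mpr hk) _).ne'
    rw [hp k hk, Gamma_nat_eq_factorial, add_comm 1 α]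
    field_simp
end

section
/- Let (v_n)_{n≥1} be a sequence of positive reals with v_n → ∞. For each n let (N_n(k))_{k≥1} be nonnegative reals with ∑_{k≥1} N_n(k) = v_n, and suppose there are nonnegative reals (p(k))_{k≥1} with ∑_{k≥1} p(k) = 1 such that N_n(k)/v_n → p(k) as n → ∞ for every fixed k ≥ 1. Then (∑_{k≥1} min(k, v_n)·N_n(k)) / v_n² → 0 as n → ∞. (This is the deterministic core of Theorem 5.4: since the number of edges of the standard projection of a binary network with degree counts N_n(k) and v_n vertices is at most ∑_k min(k, v_n)·N_n(k), and the Hollywood degree proportions converge almost surely to the probability distribution p_α, the projected network sequence is almost surely sparse.) -/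
open Filter

/-- Cutting a truncated first moment at level `K`: the terms below `K` contribute at most `K` times
the total mass, the others at most `v` times the mass they carry. -/
theorem tsum_min_mul_le_of_hasSum {f : ℕ → ℝ} {v : ℝ} (hf : ∀ k, 0 ≤ f k) (hv : 0 ≤ v)
    {s : ℝ} (hs : HasSum f s) (K : ℕ) :
    ∑' k : ℕ, min ((k + 1 : ℕ) : ℝ) v * f k ≤ K * s + v * (s - ∑ k ∈ Finset.range K, f k) := by
  have hcut : HasSum (fun k => if k ∈ Finset.range K then f k else 0)
      (∑ k ∈ Finset.range K, f k) := by
    have h := hasSum_sum_of_ne_finset_zero (f := fun k => if k ∈ Finset.range K then f k else 0)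
      (s := Finset.range K) (L := SummationFilter.unconditional ℕ) fun k hk => if_neg hk
    rwa [Finset.sum_congr rfl fun k hk => if_pos hk] at h
  have hbound := (hs.mul_left (K : ℝ)).add ((hs.sub hcut).mul_left v)
  have hsum : Summable fun k : ℕ => min ((k + 1 : ℕ) : ℝ) v * f k :=
    (hs.summable.mul_left v).of_nonneg_of_le
      (fun k => mul_nonneg (le_min (Nat.cast_nonneg _) hv) (hf k))
      fun k => mul_le_mul_of_nonneg_right (min_le_right _ _) (hf k)
  refine hasSum_le (fun k => ?_) hsum.hasSum hbound
  split_ifs with hk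
  · have hkK : ((k + 1 : ℕ) : ℝ) ≤ K := Nat.cast_le.mpr (Finset.mem_range.mp hk)
    simpa using mul_le_mul_of_nonneg_right ((min_le_left _ v).trans hkK) (hf k)
  · have h := mul_le_mul_of_nonneg_right (min_le_right ((k + 1 : ℕ) : ℝ) v) (hf k)
    have hK : 0 ≤ (K : ℝ) * f k := mul_nonneg (Nat.cast_nonneg K) (hf k)
    linarith

/-- Deterministic core of Theorem 5.4: if `v_n → ∞`, the nonnegative degree counts satisfy
`∑_{k≥1} N_n(k) = v_n`, and the degree proportions converge pointwise, `N_n(k)/v_n → p(k)`,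
to a probability distribution `(p(k))_{k≥1}`, then `(∑_{k≥1} min(k, v_n)·N_n(k))/v_n² → 0`,
so the standard projection of the corresponding binary networks is sparse. -/
theorem projected_sparsity_deterministic_core (v : ℕ → ℝ) (hvpos : ∀ n, 0 < v n)
    (hv : Tendsto v atTop atTop)
    (N : ℕ → ℕ → ℝ) (hN : ∀ n k, 0 ≤ N n k)
    (hNsum : ∀ n, HasSum (fun k : ℕ => N n (k + 1)) (v n))
    (p : ℕ → ℝ) (hp0 : ∀ k, 0 ≤ p k) (hp1 : HasSum (fun k : ℕ => p (k + 1)) 1)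
    (hconv : ∀ k : ℕ, 1 ≤ k → Tendsto (fun n => N n k / v n) atTop (nhds (p k))) :
    Tendsto (fun n : ℕ =>
      (∑' k : ℕ, min ((k + 1 : ℕ) : ℝ) (v n) * N n (k + 1)) / v n ^ 2) atTop (nhds 0) := by
  have hupper : ∀ K n, (∑' k : ℕ, min ((k + 1 : ℕ) : ℝ) (v n) * N n (k + 1)) / v n ^ 2 ≤
      K / v n + (1 - ∑ k ∈ Finset.range K, N n (k + 1) / v n) := fun K n => by
    have hvn := hvpos n
    rw [div_le_iff₀ (by positivity), ← Finset.sum_div]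
    refine (tsum_min_mul_le_of_hasSum (fun k => hN n (k + 1)) hvn.le (hNsum n) K).trans_eq ?_
    field_simp
  have hlim : ∀ K : ℕ, Tendsto
      (fun n => K / v n + (1 - ∑ k ∈ Finset.range K, N n (k + 1) / v n)) atTop
      (nhds (0 + (1 - ∑ k ∈ Finset.range K, p (k + 1)))) := fun K =>
    (hv.const_div_atTop (K : ℝ)).add
      ((tendsto_finsetSum _ fun k _ => hconv (k + 1) (Nat.le_add_left 1 k)).const_sub 1)
  refine tendsto_order.mpr ⟨fun a ha => .of_forall fun n => ha.trans_le ?_, fun ε hε => ?_⟩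
  · exact div_nonneg (tsum_nonneg fun k =>
      mul_nonneg (le_min (Nat.cast_nonneg _) (hvpos n).le) (hN n _)) (sq_nonneg _)
  · obtain ⟨K, hK⟩ := (hp1.tendsto_sum_nat.eventually
      (lt_mem_nhds (show 1 - ε < 1 by linarith))).exists
    filter_upwards [(hlim K).eventually (gt_mem_nhds (show _ < ε by linarith))] with n hn
    exact (hupper K n).trans_lt hn
end
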